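/- Let ξ be an extremal real number with an associated Fibonacci sequence (W_k)_{k≥1} in 𝒫, and for each i ≥ 1 let U_i = Φ(u_i) where u_i is the prefix of f_{a,b} of length i. If the sequence of determinants (det U_i)_{i≥1} is bounded, then ξ is badly approximable. -/

import Mathlib

open Matrix

/-- 2×2 integer matrices. -/
abbrev M2 : Type := Matrix (Fin 2) (Fin 2) ℤ

/-- The content of an integer matrix: the gcd of its coefficients. -/
def content (A : M2) : ℕ :=
  Nat.gcd (Nat.gcd (A 0 0).natAbs (A 0 1).natAbs) (Nat.gcd (A 1 0).natAbs (A 1 1).natAbs)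

/-- A matrix is primitive if its content is 1. -/
def Primitive (A : M2) : Prop := content A = 1

/-- Membership in 𝒫: primitive with nonzero determinant. -/
def MemP (A : M2) : Prop := Primitive A ∧ A.det ≠ 0

/-- `A^red`: the primitive matrix such that `A = content A • A^red`. -/
def red (A : M2) : M2 := Matrix.of fun i j => A i j / (content A : ℤ)

/-- The group operation of 𝒫: `A * B = (AB)^red`. -/
def pmul (A B : M2) : M2 := red (A * B)

/-- A Fibonacci sequence in 𝒫 (indices from 1). -/
def IsFibP (W : ℕ → M2) : Prop :=
  (∀ i, 1 ≤ i → MemP (W i)) ∧ ∀ i, 1 ≤ i → W (i + 2) = pmul (W (i + 1)) (W i)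

/-- Admissibility of a Fibonacci sequence in 𝒫: there is a non-symmetric,
non-skew-symmetric N ∈ 𝒫 such that W_i N_i is symmetric for all i ≥ 1,
where N_i = ᵗN for odd i and N_i = N for even i. -/
def AdmissibleFib (W : ℕ → M2) : Prop :=
  ∃ N : M2, MemP N ∧ N ≠ Nᵀ ∧ N ≠ -Nᵀ ∧
    ∀ i, 1 ≤ i → (W i * (if i % 2 = 1 then Nᵀ else N)).IsSymm

/-- The norm of an integer 2×2 matrix: max absolute value of coefficients, as a real. -/
noncomputable def mnorm (A : M2) : ℝ :=
  max (max |(A 0 0 : ℝ)| |(A 0 1 : ℝ)|) (max |(A 1 0 : ℝ)| |(A 1 1 : ℝ)|)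

/-- The sequence is unbounded in norm. -/
def UnboundedSeq (W : ℕ → M2) : Prop := ∀ C : ℝ, ∃ i, 1 ≤ i ∧ C < mnorm (W i)

/-- The golden ratio γ = (1+√5)/2. -/
noncomputable def gam : ℝ := (1 + Real.sqrt 5) / 2

/-- Norm of the row vector (ξ, -1)·A. -/
noncomputable def xiNorm (ξ : ℝ) (A : M2) : ℝ :=
  max |ξ * (A 0 0 : ℝ) - (A 1 0 : ℝ)| |ξ * (A 0 1 : ℝ) - (A 1 1 : ℝ)|

/-- ξ is extremal: neither rational nor quadratic over ℚ, and for each X ≥ 1 the system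
|x₀| ≤ X, |x₀ξ - x₁| ≤ c X^(-1/γ), |x₀ξ² - x₂| ≤ c X^(-1/γ) has a nonzero integer solution. -/
def IsExtremal (ξ : ℝ) : Prop :=
  (∀ a b c : ℚ, ¬(a = 0 ∧ b = 0 ∧ c = 0) → (a : ℝ) * ξ ^ 2 + (b : ℝ) * ξ + (c : ℝ) ≠ 0) ∧
  ∃ c : ℝ, 0 < c ∧ ∀ X : ℝ, 1 ≤ X → ∃ x₀ x₁ x₂ : ℤ,
    ¬(x₀ = 0 ∧ x₁ = 0 ∧ x₂ = 0) ∧ |(x₀ : ℝ)| ≤ X ∧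
    |(x₀ : ℝ) * ξ - (x₁ : ℝ)| ≤ c * X ^ (-1 / gam) ∧
    |(x₀ : ℝ) * ξ ^ 2 - (x₂ : ℝ)| ≤ c * X ^ (-1 / gam)

/-- The Fibonacci sequence `W` in 𝒫 is associated to the extremal real number ξ:
it is an unbounded admissible Fibonacci sequence in 𝒫 with
‖W_{i+1}‖ ≍ ‖W_i‖^γ, ‖(ξ,-1)W_i‖ ≍ ‖W_i‖⁻¹ and |det W_i| ≍ 1. -/
def IsAssociated (ξ : ℝ) (W : ℕ → M2) : Prop :=
  IsFibP W ∧ UnboundedSeq W ∧ AdmissibleFib W ∧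
  ∃ c₁ c₂ c₃ c₄ c₅ c₆ : ℝ, 0 < c₁ ∧ 0 < c₂ ∧ 0 < c₃ ∧ 0 < c₄ ∧ 0 < c₅ ∧ 0 < c₆ ∧
    ∀ i, 1 ≤ i →
      c₁ * mnorm (W i) ^ gam ≤ mnorm (W (i + 1)) ∧
      mnorm (W (i + 1)) ≤ c₂ * mnorm (W i) ^ gam ∧
      c₃ * (mnorm (W i))⁻¹ ≤ xiNorm ξ (W i) ∧
      xiNorm ξ (W i) ≤ c₄ * (mnorm (W i))⁻¹ ∧
      c₅ ≤ |((W i).det : ℝ)| ∧ |((W i).det : ℝ)| ≤ c₆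

/-- Membership in GL₂(ℤ): integer matrix of determinant ±1. -/
def InGL2Z (A : M2) : Prop := A.det = 1 ∨ A.det = -1

/-- ξ is badly approximable: irrational and |ξ - p/q| > c/q² for all rationals p/q. -/
def BadlyApprox (ξ : ℝ) : Prop :=
  Irrational ξ ∧ ∃ c : ℝ, 0 < c ∧ ∀ p q : ℤ, q ≠ 0 → c / (q : ℝ) ^ 2 < |ξ - (p : ℝ) / (q : ℝ)|

/-- Partial quotients of the continued fraction expansion: `cfA n ξ` is `aₙ`
where ξ = [a₀, a₁, a₂, …]. -/
noncomputable def cfA : ℕ → ℝ → ℤ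
  | 0, ξ => ⌊ξ⌋
  | n + 1, ξ => cfA n (ξ - ⌊ξ⌋)⁻¹

/-- A Fibonacci sequence of words (indices from 1). -/
def FibWordSeq {α : Type} (w : ℕ → List α) : Prop := ∀ i, 1 ≤ i → w (i + 2) = w (i + 1) ++ w i

/-- `b` (indexed from 1: the limit word is b₁b₂b₃…) is the infinite limit word of the
sequence of words `w`: every `w k` (k ≥ 2) is a prefix of it, and their lengths are unbounded. -/
def IsLimitWord {α : Type} (w : ℕ → List α) (b : ℕ → α) : Prop :=
  (∀ n : ℕ, ∃ k, 2 ≤ k ∧ n ≤ (w k).length) ∧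
  ∀ k, 2 ≤ k → ∀ j, (h : j < (w k).length) → (w k).get ⟨j, h⟩ = b (j + 1)

/-- The Fibonacci sequence of words over the alphabet E = {a, b} (with `b = false`,
`a = true`): w₁ = b, w₂ = a, w_{k+2} = w_{k+1} w_k.  Its limit is f_{a,b}. -/
def fw : ℕ → List Bool
  | 0 => []
  | 1 => [false]
  | 2 => [true]
  | n + 3 => fw (n + 2) ++ fw (n + 1)

/-- The prefix of length `i` of the infinite Fibonacci word `f_{a,b}`
(note `fw (i+2)` is a prefix of `f_{a,b}` of length ≥ i). -/
def fpref (i : ℕ) : List Bool := (fw (i + 2)).take i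

/-- The monoid morphism Φ : E* → (𝒫, *) with Φ(b) = W₁, Φ(a) = W₂
(the letter `b` is `false` and `a` is `true`). -/
def PhiW (W1 W2 : M2) : List Bool → M2
  | [] => 1
  | x :: u => pmul (if x then W2 else W1) (PhiW W1 W2 u)

/-- The set 𝒮₁ of real matrices (a b; c d) with a ≥ max{b,c} and min{b,c} ≥ d ≥ 0. -/
def S1 : Set (Matrix (Fin 2) (Fin 2) ℝ) :=
  {A | max (A 0 1) (A 1 0) ≤ A 0 0 ∧ A 1 1 ≤ min (A 0 1) (A 1 0) ∧ 0 ≤ A 1 1}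

/-- The set 𝒮 = 𝒮₁ ∩ GL₂(ℤ), viewed as a set of integer matrices. -/
def Sset : Set M2 :=
  {A | (A.map (Int.cast : ℤ → ℝ)) ∈ S1 ∧ (A.det = 1 ∨ A.det = -1)}

/-- ξ is an extremal real number with an associated Fibonacci sequence in GL₂(ℤ). -/
def HasGLAssoc (ξ : ℝ) : Prop :=
  IsExtremal ξ ∧ ∃ W : ℕ → M2, IsAssociated ξ W ∧ ∀ i, 1 ≤ i → InGL2Z (W i)

/-- ξ is an extremal real number with an associated Fibonacci sequence in 𝒮. -/
def HasSAssoc (ξ : ℝ) : Prop :=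
  IsExtremal ξ ∧ ∃ W : ℕ → M2, IsAssociated ξ W ∧ ∀ i, 1 ≤ i → W i ∈ Sset

/-! ### Content and reduction -/

lemma content_dvd (A : M2) (i j : Fin 2) : (content A : ℤ) ∣ A i j := by
  rw [Int.natCast_dvd]
  have h1 := Nat.gcd_dvd_left (Nat.gcd (A 0 0).natAbs (A 0 1).natAbs)
    (Nat.gcd (A 1 0).natAbs (A 1 1).natAbs)
  have h2 := Nat.gcd_dvd_right (Nat.gcd (A 0 0).natAbs (A 0 1).natAbs)
    (Nat.gcd (A 1 0).natAbs (A 1 1).natAbs)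
  fin_cases i <;> fin_cases j
  · exact h1.trans (Nat.gcd_dvd_left _ _)
  · exact h1.trans (Nat.gcd_dvd_right _ _)
  · exact h2.trans (Nat.gcd_dvd_left _ _)
  · exact h2.trans (Nat.gcd_dvd_right _ _)

lemma content_smul_red (A : M2) : (content A : ℤ) • red A = A := by
  ext i j
  simp only [Matrix.smul_apply, smul_eq_mul, red, Matrix.of_apply]
  exact Int.mul_ediv_cancel' (content_dvd A i j)

lemma content_pos {A : M2} (hA : A ≠ 0) : 0 < content A := by
  rcases Nat.eq_zero_or_pos (content A) with h | h
  · refine absurd ?_ hA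
    rw [← content_smul_red A, h]
    simp
  · exact h

lemma ne_zero_of_det_ne_zero {A : M2} (hA : A.det ≠ 0) : A ≠ 0 := by
  rintro rfl
  simp at hA

lemma red_zero : red 0 = 0 := by
  ext i j
  simp [red]

lemma content_smul (c : ℕ) (A : M2) : content ((c : ℤ) • A) = c * content A := by
  simp [content, Int.natAbs_mul, Nat.gcd_mul_left]

lemma red_smul {c : ℕ} (hc : 0 < c) (A : M2) : red ((c : ℤ) • A) = red A := by
  ext i j
  simp only [red, content_smul, Matrix.of_apply, Matrix.smul_apply, smul_eq_mul, Nat.cast_mul]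
  exact Int.mul_ediv_mul_of_pos _ _ (by exact_mod_cast hc)

lemma red_of_primitive {A : M2} (hA : Primitive A) : red A = A := by
  have h := content_smul_red A
  rw [hA] at h
  simpa using h

lemma red_mul_red (A B : M2) : red (A * red B) = red (A * B) := by
  rcases eq_or_ne B 0 with rfl | hB
  · simp [red_zero]
  · conv_rhs => rw [← content_smul_red B, Matrix.mul_smul, red_smul (content_pos hB)]

lemma red_red_mul (A B : M2) : red (red A * B) = red (A * B) := by
  rcases eq_or_ne A 0 with rfl | hA
  · simp [red_zero]
  · conv_rhs => rw [← content_smul_red A, Matrix.smul_mul, red_smul (content_pos hA)]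

lemma primitive_one : Primitive (1 : M2) := by
  simp [Primitive, content]

lemma PhiW_eq_red_prod (A B : M2) (u : List Bool) :
    PhiW A B u = red (u.map fun x => if x then B else A).prod := by
  induction u with
  | nil => simp [PhiW, red_of_primitive primitive_one]
  | cons x u ih => simp only [PhiW, ih, pmul, red_mul_red, List.map_cons, List.prod_cons]

lemma det_list_prod_ne_zero {ι : Type*} (h : ι → M2) (hh : ∀ x, (h x).det ≠ 0) (u : List ι) :
    (u.map h).prod.det ≠ 0 := by
  induction u with
  | nil => simp
  | cons x u ih => simpa [Matrix.det_mul] using ⟨hh x, ih⟩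

/-! ### Norm estimates -/

lemma abs_le_mnorm (A : M2) (i j : Fin 2) : |(A i j : ℝ)| ≤ mnorm A := by
  fin_cases i <;> fin_cases j <;> simp [mnorm]

lemma mnorm_le {A : M2} {c : ℝ} (h : ∀ i j, |(A i j : ℝ)| ≤ c) : mnorm A ≤ c := by
  simp [mnorm, h]

lemma mnorm_nonneg (A : M2) : 0 ≤ mnorm A := (abs_nonneg _).trans (abs_le_mnorm A 0 0)

lemma abs_le_xiNorm (ξ : ℝ) (A : M2) (j : Fin 2) :
    |ξ * (A 0 j : ℝ) - (A 1 j : ℝ)| ≤ xiNorm ξ A := by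
  fin_cases j <;> simp [xiNorm]

lemma xiNorm_nonneg (ξ : ℝ) (A : M2) : 0 ≤ xiNorm ξ A :=
  (abs_nonneg _).trans (abs_le_xiNorm ξ A 0)

lemma mnorm_smul (c : ℕ) (A : M2) : mnorm ((c : ℤ) • A) = c * mnorm A := by
  simp [mnorm, abs_mul, mul_max_of_nonneg]

lemma xiNorm_smul (ξ : ℝ) (c : ℕ) (A : M2) : xiNorm ξ ((c : ℤ) • A) = c * xiNorm ξ A := by
  have h : ∀ x y : ℝ, |ξ * ((c : ℝ) * x) - c * y| = c * |ξ * x - y| := fun x y => by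
    rw [← abs_of_nonneg (Nat.cast_nonneg (α := ℝ) c), ← abs_mul,
      abs_of_nonneg (Nat.cast_nonneg (α := ℝ) c)]
    congr 1
    ring
  simp [xiNorm, h, mul_max_of_nonneg]

lemma mnorm_red_le (A : M2) : mnorm (red A) ≤ mnorm A := by
  rcases eq_or_ne A 0 with rfl | hA
  · rw [red_zero]
  · conv_rhs => rw [← content_smul_red A, mnorm_smul]
    have : (1 : ℝ) ≤ content A := by exact_mod_cast content_pos hA
    nlinarith [mnorm_nonneg (red A)]

lemma mnorm_mul_le (A B : M2) : mnorm (A * B) ≤ 2 * (mnorm A * mnorm B) := by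
  refine mnorm_le fun i j => ?_
  have h : ∀ k, |(A i k : ℝ)| * |(B k j : ℝ)| ≤ mnorm A * mnorm B := fun k =>
    mul_le_mul (abs_le_mnorm A i k) (abs_le_mnorm B k j) (abs_nonneg _) (mnorm_nonneg A)
  rw [Matrix.mul_apply, Fin.sum_univ_two]
  push_cast
  refine (abs_add_le _ _).trans ?_
  rw [abs_mul, abs_mul]
  linarith [h 0, h 1]

/-- `‖(ξ, -1)A‖ ‖A‖ ≤ C |det A|`, which is invariant under scaling. -/
def DetControlled (ξ C : ℝ) (A : M2) : Prop :=
  xiNorm ξ A * mnorm A ≤ C * |(A.det : ℝ)|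

lemma detControlled_smul {ξ C : ℝ} {c : ℕ} (hc : 0 < c) (A : M2) :
    DetControlled ξ C ((c : ℤ) • A) ↔ DetControlled ξ C A := by
  have h : (0 : ℝ) < (c : ℝ) ^ 2 := by positivity
  rw [DetControlled, DetControlled, xiNorm_smul, mnorm_smul, Matrix.det_smul]
  simp only [Fintype.card_fin, Int.cast_mul, Int.cast_pow, Int.cast_natCast, abs_mul, abs_pow,
    Nat.abs_cast]
  rw [show (c : ℝ) * xiNorm ξ A * (c * mnorm A) = (c : ℝ) ^ 2 * (xiNorm ξ A * mnorm A) by ring,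
    show C * ((c : ℝ) ^ 2 * |(A.det : ℝ)|) = (c : ℝ) ^ 2 * (C * |(A.det : ℝ)|) by ring]
  exact mul_le_mul_iff_right₀ h

lemma detControlled_red {ξ C : ℝ} {A : M2} (hA : A ≠ 0) :
    DetControlled ξ C (red A) ↔ DetControlled ξ C A := by
  conv_rhs => rw [← content_smul_red A]
  exact (detControlled_smul (content_pos hA) _).symm

lemma abs_det_mul_xiNorm_le (ξ : ℝ) (U V : M2) :
    |(V.det : ℝ)| * xiNorm ξ U ≤ 2 * (xiNorm ξ (U * V) * mnorm V) := by
  have key : ∀ j, |(V.det : ℝ)| * |ξ * (U 0 j : ℝ) - (U 1 j : ℝ)| ≤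
      2 * (xiNorm ξ (U * V) * mnorm V) := by
    intro j
    have h : ∀ k i l, |ξ * ((U * V) 0 k : ℝ) - ((U * V) 1 k : ℝ)| * |(V i l : ℝ)| ≤
        xiNorm ξ (U * V) * mnorm V := fun k i l =>
      mul_le_mul (abs_le_xiNorm ξ _ k) (abs_le_mnorm V i l) (abs_nonneg _) (xiNorm_nonneg _ _)
    rw [← abs_mul]
    fin_cases j
    · have e : (V.det : ℝ) * (ξ * (U 0 0 : ℝ) - (U 1 0 : ℝ)) =
          (ξ * ((U * V) 0 0 : ℝ) - ((U * V) 1 0 : ℝ)) * (V 1 1 : ℝ) -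
          (ξ * ((U * V) 0 1 : ℝ) - ((U * V) 1 1 : ℝ)) * (V 1 0 : ℝ) := by
        simp only [Matrix.mul_apply, Fin.sum_univ_two, Matrix.det_fin_two]
        push_cast
        ring
      change |(V.det : ℝ) * (ξ * (U 0 0 : ℝ) - (U 1 0 : ℝ))| ≤ _
      rw [e]
      refine (abs_sub _ _).trans ?_
      rw [abs_mul, abs_mul]
      linarith [h 0 1 1, h 1 1 0]
    · have e : (V.det : ℝ) * (ξ * (U 0 1 : ℝ) - (U 1 1 : ℝ)) =
          (ξ * ((U * V) 0 1 : ℝ) - ((U * V) 1 1 : ℝ)) * (V 0 0 : ℝ) -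
          (ξ * ((U * V) 0 0 : ℝ) - ((U * V) 1 0 : ℝ)) * (V 0 1 : ℝ) := by
        simp only [Matrix.mul_apply, Fin.sum_univ_two, Matrix.det_fin_two]
        push_cast
        ring
      change |(V.det : ℝ) * (ξ * (U 0 1 : ℝ) - (U 1 1 : ℝ))| ≤ _
      rw [e]
      refine (abs_sub _ _).trans ?_
      rw [abs_mul, abs_mul]
      linarith [h 1 0 0, h 0 0 1]
  have h0 := key 0
  have h1 := key 1
  rw [xiNorm, mul_max_of_nonneg _ _ (abs_nonneg _)]
  exact max_le h0 h1

lemma DetControlled.left_factor {ξ C c : ℝ} (hc : 0 < c) {U V : M2} (hV : V.det ≠ 0)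
    (hUV : mnorm U * mnorm V ≤ c * mnorm (U * V)) (h : DetControlled ξ C (U * V)) :
    DetControlled ξ (2 * c * C) U := by
  have hV' : (0 : ℝ) < |(V.det : ℝ)| := by
    rw [abs_pos]
    exact_mod_cast hV
  rw [DetControlled] at h ⊢
  rw [Matrix.det_mul, Int.cast_mul, abs_mul] at h
  refine le_of_mul_le_mul_left ?_ hV'
  calc |(V.det : ℝ)| * (xiNorm ξ U * mnorm U)
      = (|(V.det : ℝ)| * xiNorm ξ U) * mnorm U := by ring
    _ ≤ 2 * (xiNorm ξ (U * V) * mnorm V) * mnorm U :=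
        mul_le_mul_of_nonneg_right (abs_det_mul_xiNorm_le ξ U V) (mnorm_nonneg U)
    _ = 2 * xiNorm ξ (U * V) * (mnorm U * mnorm V) := by ring
    _ ≤ 2 * xiNorm ξ (U * V) * (c * mnorm (U * V)) :=
        mul_le_mul_of_nonneg_left hUV (by linarith [xiNorm_nonneg ξ (U * V)])
    _ = 2 * c * (xiNorm ξ (U * V) * mnorm (U * V)) := by ring
    _ ≤ 2 * c * (C * (|(U.det : ℝ)| * |(V.det : ℝ)|)) :=
        mul_le_mul_of_nonneg_left h (by linarith)
    _ = |(V.det : ℝ)| * (2 * c * C * |(U.det : ℝ)|) := by ring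

/-! ### Coordinates adapted to the direction `(1, ξ)` -/

/-- The matrix `A` in the basis `(1, ξ), (0, δ)` of `ℝ²`. -/
noncomputable def adaptedCoords (ξ δ : ℝ) (A : M2) : Matrix (Fin 2) (Fin 2) ℝ :=
  !![(A 0 0 : ℝ) + ξ * A 0 1, δ * A 0 1;
    -((ξ * A 0 0 - A 1 0) + ξ * (ξ * A 0 1 - A 1 1)) / δ, -(ξ * A 0 1 - A 1 1)]

lemma adaptedCoords_one (ξ δ : ℝ) : adaptedCoords ξ δ 1 = 1 := by
  ext i j
  fin_cases i <;> fin_cases j <;> simp [adaptedCoords]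

lemma adaptedCoords_mul {ξ δ : ℝ} (hδ : δ ≠ 0) (A B : M2) :
    adaptedCoords ξ δ (A * B) = adaptedCoords ξ δ A * adaptedCoords ξ δ B := by
  ext i j
  fin_cases i <;> fin_cases j <;>
    simp [adaptedCoords, Matrix.mul_apply, Fin.sum_univ_two] <;> field_simp <;> ring

lemma adaptedCoords_smul (ξ δ : ℝ) (c : ℤ) (A : M2) :
    adaptedCoords ξ δ (c • A) = (c : ℝ) • adaptedCoords ξ δ A := by
  ext i j
  fin_cases i <;> fin_cases j <;> simp [adaptedCoords] <;> ring

lemma abs_adaptedCoords_zero_zero_le (ξ δ : ℝ) (A : M2) :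
    |adaptedCoords ξ δ A 0 0| ≤ (1 + |ξ|) * mnorm A := by
  change |(A 0 0 : ℝ) + ξ * A 0 1| ≤ _
  refine (abs_add_le _ _).trans ?_
  rw [abs_mul]
  nlinarith [abs_le_mnorm A 0 0, mul_le_mul_of_nonneg_left (abs_le_mnorm A 0 1) (abs_nonneg ξ)]

/-- Real matrices contracting a neighbourhood of the direction `e₁`, and a neighbourhood of
the dual direction. -/
def Contracting (M : Matrix (Fin 2) (Fin 2) ℝ) : Prop :=
  0 < |M 0 0| ∧ |M 0 1| ≤ |M 0 0| / 2 ∧ |M 1 0| ≤ |M 0 0| / 8 ∧ |M 1 1| ≤ |M 0 0| / 8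

lemma Contracting.of_smul {c : ℝ} (hc : c ≠ 0) {M : Matrix (Fin 2) (Fin 2) ℝ}
    (h : Contracting M) : Contracting (c • M) := by
  have hc' : 0 < |c| := abs_pos.mpr hc
  obtain ⟨h0, h1, h2, h3⟩ := h
  simp only [Contracting, Matrix.smul_apply, smul_eq_mul, abs_mul]
  refine ⟨by positivity, ?_, ?_, ?_⟩ <;> rw [mul_div_assoc] <;>
    exact mul_le_mul_of_nonneg_left ‹_› hc'.le

lemma abs_mul_add_mul_ge {a b x y β η : ℝ} (hb : |b| ≤ β * |a|) (hy : |y| ≤ η * |x|)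
    (hβ : 0 ≤ β) : (1 - β * η) * (|a| * |x|) ≤ |a * x + b * y| := by
  have h1 : |a * x| - |b * y| ≤ |a * x + b * y| := by
    have := abs_sub_abs_le_abs_sub (a * x) (-(b * y))
    rwa [abs_neg, sub_neg_eq_add] at this
  have h2 : |b| * |y| ≤ (β * |a|) * (η * |x|) :=
    mul_le_mul hb hy (abs_nonneg _) (by positivity)
  rw [abs_mul, abs_mul] at h1
  linarith

lemma Contracting.list_prod_column {l : List (Matrix (Fin 2) (Fin 2) ℝ)}
    (hl : ∀ M ∈ l, Contracting M) :
    0 < |l.prod 0 0| ∧ |l.prod 1 0| ≤ 1 / 4 * |l.prod 0 0| := by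
  induction l with
  | nil => simp
  | cons M l ih =>
    obtain ⟨g0, g1, g2, g3⟩ := hl M (by simp)
    obtain ⟨i0, i1⟩ := ih fun N hN => hl N (by simp [hN])
    rw [List.prod_cons, Matrix.mul_apply, Matrix.mul_apply, Fin.sum_univ_two, Fin.sum_univ_two]
    have h1 := abs_mul_add_mul_ge (a := M 0 0) (b := M 0 1) (β := 1 / 2) (by linarith) i1
      (by norm_num)
    have h3 : 0 < |M 0 0| * |l.prod 0 0| := by positivity
    refine ⟨by linarith, ?_⟩
    refine (abs_add_le _ _).trans ?_
    rw [abs_mul, abs_mul]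
    have h5 : |M 1 0| * |l.prod 0 0| ≤ |M 0 0| / 8 * |l.prod 0 0| :=
      mul_le_mul_of_nonneg_right g2 i0.le
    have h6 : |M 1 1| * |l.prod 1 0| ≤ |M 0 0| / 8 * (1 / 4 * |l.prod 0 0|) :=
      mul_le_mul g3 i1 (abs_nonneg _) (by positivity)
    linarith

lemma Contracting.list_prod_row {l : List (Matrix (Fin 2) (Fin 2) ℝ)}
    (hl : ∀ M ∈ l, Contracting M) : |l.prod 0 1| ≤ |l.prod 0 0| := by
  induction l using List.reverseRecOn with
  | nil => simp
  | append_singleton l M ih =>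
    obtain ⟨g0, g1, g2, g3⟩ := hl M (by simp)
    have i1 := ih fun N hN => hl N (by simp [hN])
    rw [List.prod_append, List.prod_singleton, Matrix.mul_apply, Matrix.mul_apply,
      Fin.sum_univ_two, Fin.sum_univ_two]
    have h1 := abs_mul_add_mul_ge (a := l.prod 0 0) (b := l.prod 0 1) (x := M 0 0) (y := M 1 0)
      (β := 1) (η := 1 / 8) (by linarith) (by linarith) (by norm_num)
    refine (abs_add_le _ _).trans ?_
    rw [abs_mul, abs_mul]
    have h5 : |l.prod 0 0| * |M 0 1| ≤ |l.prod 0 0| * (|M 0 0| / 2) :=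
      mul_le_mul_of_nonneg_left g1 (abs_nonneg _)
    have h6 : |l.prod 0 1| * |M 1 1| ≤ |l.prod 0 0| * (|M 0 0| / 8) :=
      mul_le_mul i1 g3 (abs_nonneg _) (abs_nonneg _)
    nlinarith [mul_nonneg (abs_nonneg (l.prod 0 0)) g0.le]

lemma Contracting.list_prod_corner {l : List (Matrix (Fin 2) (Fin 2) ℝ)}
    (hl : ∀ M ∈ l, Contracting M) : |l.prod 1 1| ≤ |l.prod 0 0| := by
  induction l with
  | nil => simp
  | cons M l ih =>
    obtain ⟨g0, g1, g2, g3⟩ := hl M (by simp)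
    have hl' : ∀ N ∈ l, Contracting N := fun N hN => hl N (by simp [hN])
    have i1 := ih hl'
    have i2 := Contracting.list_prod_row hl'
    obtain ⟨i3, i4⟩ := Contracting.list_prod_column hl'
    rw [List.prod_cons, Matrix.mul_apply, Matrix.mul_apply, Fin.sum_univ_two, Fin.sum_univ_two]
    have h1 := abs_mul_add_mul_ge (a := M 0 0) (b := M 0 1) (β := 1 / 2) (by linarith) i4
      (by norm_num)
    have h3 : 0 < |M 0 0| * |l.prod 0 0| := by positivity
    refine (abs_add_le _ _).trans ?_
    rw [abs_mul, abs_mul]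
    have h5 : |M 1 0| * |l.prod 0 1| ≤ |M 0 0| / 8 * |l.prod 0 0| :=
      mul_le_mul g2 i2 (abs_nonneg _) (by positivity)
    have h6 : |M 1 1| * |l.prod 1 1| ≤ |M 0 0| / 8 * |l.prod 0 0| :=
      mul_le_mul g3 i1 (abs_nonneg _) (by positivity)
    linarith

lemma adaptedCoords_list_prod {ξ δ : ℝ} (hδ : δ ≠ 0) (l : List M2) :
    adaptedCoords ξ δ l.prod = (l.map (adaptedCoords ξ δ)).prod := by
  induction l with
  | nil => simp [adaptedCoords_one]
  | cons A l ih => simp [adaptedCoords_mul hδ, ih]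

lemma exists_mnorm_le_adaptedCoords (ξ : ℝ) {δ : ℝ} (hδ : 0 < δ) :
    ∃ K : ℝ, 0 < K ∧ ∀ (A : M2) (t : ℝ), (∀ i j, |adaptedCoords ξ δ A i j| ≤ t) →
      mnorm A ≤ K * t := by
  refine ⟨(1 + |ξ|) ^ 2 * (δ⁻¹ + 1) + δ, by positivity, fun A t ht => ?_⟩
  have h00 := ht 0 0
  have h01 := ht 0 1
  have h10 := ht 1 0
  have h11 := ht 1 1
  set a := adaptedCoords ξ δ A 0 0 with ha
  set b := adaptedCoords ξ δ A 0 1 with hb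
  set c := adaptedCoords ξ δ A 1 0 with hc
  set d := adaptedCoords ξ δ A 1 1 with hd
  simp only [adaptedCoords, Matrix.of_apply, Matrix.cons_val', Matrix.cons_val_zero,
    Matrix.cons_val_one, Matrix.cons_val_fin_one] at ha hb hc hd
  have ht0 : 0 ≤ t := (abs_nonneg _).trans h00
  have hx := abs_nonneg ξ
  have hd0 : 0 < δ⁻¹ := inv_pos.mpr hδ
  have e01 : (A 0 1 : ℝ) = δ⁻¹ * b := by rw [hb]; field_simp
  have e00 : (A 0 0 : ℝ) = a - ξ * A 0 1 := by rw [ha]; ring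
  have e11 : (A 1 1 : ℝ) = ξ * A 0 1 + d := by rw [hd]; ring
  have e10 : (A 1 0 : ℝ) = ξ * A 0 0 + (δ * c - ξ * d) := by
    rw [hc, hd]
    field_simp
    ring
  have b01 : |(A 0 1 : ℝ)| ≤ δ⁻¹ * t := by
    rw [e01, abs_mul, abs_of_pos hd0]
    gcongr
  have bξ : |ξ| * |(A 0 1 : ℝ)| ≤ |ξ| * (δ⁻¹ * t) := by gcongr
  have b00 : |(A 0 0 : ℝ)| ≤ t + |ξ| * (δ⁻¹ * t) := by
    rw [e00]
    refine (abs_sub _ _).trans ?_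
    rw [abs_mul]
    linarith
  have b11 : |(A 1 1 : ℝ)| ≤ |ξ| * (δ⁻¹ * t) + t := by
    rw [e11]
    refine (abs_add_le _ _).trans ?_
    rw [abs_mul]
    linarith
  have b10 : |(A 1 0 : ℝ)| ≤ |ξ| * (t + |ξ| * (δ⁻¹ * t)) + (δ * t + |ξ| * t) := by
    rw [e10]
    refine (abs_add_le _ _).trans (add_le_add ?_ ((abs_sub _ _).trans (add_le_add ?_ ?_)))
    · rw [abs_mul]
      gcongr
    · rw [abs_mul, abs_of_pos hδ]
      gcongr
    · rw [abs_mul]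
      gcongr
  have p1 : 0 ≤ δ⁻¹ * t := by positivity
  have p2 : 0 ≤ |ξ| * (δ⁻¹ * t) := by positivity
  have p3 : 0 ≤ |ξ| * t := by positivity
  have p4 : 0 ≤ |ξ| * (|ξ| * (δ⁻¹ * t)) := by positivity
  have p5 : 0 ≤ |ξ| * (|ξ| * t) := by positivity
  have p6 : 0 ≤ δ * t := by positivity
  refine mnorm_le fun i j => ?_
  fin_cases i <;> fin_cases j
  · refine b00.trans ?_
    linarith
  · refine b01.trans ?_
    linarith
  · refine b10.trans ?_
    linarith
  · refine b11.trans ?_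
    linarith

lemma exists_mnorm_mul_le (ξ : ℝ) {δ : ℝ} (hδ : 0 < δ) :
    ∃ c : ℝ, 0 < c ∧ ∀ l l' : List M2, (∀ A ∈ l, Contracting (adaptedCoords ξ δ A)) →
      (∀ A ∈ l', Contracting (adaptedCoords ξ δ A)) →
      mnorm l.prod * mnorm l'.prod ≤ c * mnorm (l.prod * l'.prod) := by
  obtain ⟨K, hK, hKA⟩ := exists_mnorm_le_adaptedCoords ξ hδ
  have bound : ∀ l : List M2, (∀ A ∈ l, Contracting (adaptedCoords ξ δ A)) →
      |adaptedCoords ξ δ l.prod 0 1| ≤ 1 * |adaptedCoords ξ δ l.prod 0 0| ∧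
      |adaptedCoords ξ δ l.prod 1 0| ≤ 1 / 4 * |adaptedCoords ξ δ l.prod 0 0| ∧
      mnorm l.prod ≤ K * |adaptedCoords ξ δ l.prod 0 0| := by
    intro l hl
    have hl' : ∀ M ∈ l.map (adaptedCoords ξ δ), Contracting M := by
      simpa using hl
    have h1 := Contracting.list_prod_row hl'
    obtain ⟨h2, h3⟩ := Contracting.list_prod_column hl'
    have h4 := Contracting.list_prod_corner hl'
    rw [← adaptedCoords_list_prod hδ.ne'] at h1 h2 h3 h4
    refine ⟨by linarith, h3, hKA _ _ fun i j => ?_⟩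
    fin_cases i <;> fin_cases j
    · exact le_rfl
    · exact h1
    · exact h3.trans (by linarith)
    · exact h4
  refine ⟨2 * K ^ 2 * (1 + |ξ|), by positivity, fun l l' hl hl' => ?_⟩
  obtain ⟨h1, -, h3⟩ := bound l hl
  obtain ⟨-, h5, h6⟩ := bound l' hl'
  have h7 := abs_mul_add_mul_ge h1 h5 zero_le_one
  have h8 := abs_adaptedCoords_zero_zero_le ξ δ (l.prod * l'.prod)
  rw [adaptedCoords_mul hδ.ne', Matrix.mul_apply, Fin.sum_univ_two] at h8
  have h9 := mul_le_mul h3 h6 (mnorm_nonneg _) (by positivity)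
  set x := |adaptedCoords ξ δ l.prod 0 0|
  set y := |adaptedCoords ξ δ l'.prod 0 0|
  have hxy : 0 ≤ x * y := by positivity
  have h10 : x * y ≤ 2 * ((1 + |ξ|) * mnorm (l.prod * l'.prod)) := by linarith
  calc _ ≤ K * x * (K * y) := h9
    _ = K ^ 2 * (x * y) := by ring
    _ ≤ K ^ 2 * (2 * ((1 + |ξ|) * mnorm (l.prod * l'.prod))) := by gcongr
    _ = _ := by ring

/-! ### Contraction for the matrices of an associated sequence -/

lemma exists_mnorm_le_abs_of_isSymm {ξ : ℝ}
    (hξ : ∀ a b c : ℚ, ¬(a = 0 ∧ b = 0 ∧ c = 0) → (a : ℝ) * ξ ^ 2 + (b : ℝ) * ξ + (c : ℝ) ≠ 0)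
    {N : M2} (hN : N ≠ -Nᵀ) {c : ℝ} (hc : 0 ≤ c) :
    ∃ κ L : ℝ, 0 < κ ∧ ∀ A : M2, (A * N).IsSymm → L ≤ mnorm A → xiNorm ξ A ≤ c →
      κ * mnorm A ≤ |(A 0 0 : ℝ) + ξ * A 0 1| := by
  set α : ℝ := N 0 1 - ξ * N 0 0 with hα
  set β : ℝ := N 1 1 - ξ * N 1 0 with hβ
  have hΔ : β - ξ * α ≠ 0 := by
    have h := hξ (N 0 0) (-(N 1 0 + N 0 1)) (N 1 1) ?_
    · convert h using 1
      push_cast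
      rw [hα, hβ]
      ring
    · rintro ⟨h1, h2, h3⟩
      apply hN
      have h1' : N 0 0 = 0 := by exact_mod_cast h1
      have h2' : -(N 1 0 + N 0 1) = 0 := by exact_mod_cast h2
      have h3' : N 1 1 = 0 := by exact_mod_cast h3
      ext i j
      fin_cases i <;> fin_cases j <;> simp <;> omega
  set Δ := |β - ξ * α|
  have hΔ' : 0 < Δ := abs_pos.mpr hΔ
  have hn := mnorm_nonneg N
  set E : ℝ := 2 * c * mnorm N with hE
  have hE0 : 0 ≤ E := by positivity
  set P : ℝ := (1 + |ξ|) * (|α| + |β|) + 1 with hP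
  have hP0 : 0 < P := by positivity
  set Q : ℝ := (1 + |ξ|) ^ 2 * E + c * Δ with hQ
  refine ⟨Δ / (2 * P), 2 * Q / Δ, by positivity, fun A hA hL hξA => ?_⟩
  set s : ℝ := (A 0 0 : ℝ) + ξ * A 0 1 with hs
  set e : ℝ := α * A 0 0 + β * A 0 1 with he
  have hd0 := (abs_le_xiNorm ξ A 0).trans hξA
  have hd1 := (abs_le_xiNorm ξ A 1).trans hξA
  have hee : |e| ≤ E := by
    have hsym : ((A * N) 0 1 : ℝ) = (A * N) 1 0 := by exact_mod_cast hA.apply 1 0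
    simp only [Matrix.mul_apply, Fin.sum_univ_two] at hsym
    push_cast at hsym
    have : e = -((ξ * A 0 0 - A 1 0) * N 0 0 + (ξ * A 0 1 - A 1 1) * N 1 0) := by
      rw [he, hα, hβ]
      linarith
    rw [this, abs_neg]
    refine (abs_add_le _ _).trans ?_
    rw [abs_mul, abs_mul]
    have h1 := mul_le_mul hd0 (abs_le_mnorm N 0 0) (abs_nonneg _) hc
    have h2 := mul_le_mul hd1 (abs_le_mnorm N 1 0) (abs_nonneg _) hc
    linarith
  have hx : Δ * |(A 0 0 : ℝ)| ≤ |β| * |s| + |ξ| * E := by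
    rw [← abs_mul, show (β - ξ * α) * (A 0 0 : ℝ) = β * s - ξ * e by rw [hs, he]; ring]
    refine (abs_sub _ _).trans ?_
    rw [abs_mul, abs_mul]
    gcongr
  have hy : Δ * |(A 0 1 : ℝ)| ≤ |α| * |s| + E := by
    rw [← abs_mul, show (β - ξ * α) * (A 0 1 : ℝ) = e - α * s by rw [hs, he]; ring]
    refine (abs_sub _ _).trans ?_
    rw [abs_mul]
    linarith
  have hξ0 := abs_nonneg ξ
  have top : ∀ j, Δ * |(A 0 j : ℝ)| ≤ (|α| + |β|) * |s| + (1 + |ξ|) * E := by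
    have h1 : 0 ≤ |ξ| * E := by positivity
    have h2 : 0 ≤ |α| * |s| := by positivity
    have h3 : 0 ≤ |β| * |s| := by positivity
    intro j
    fin_cases j
    · exact hx.trans (by linarith)
    · exact hy.trans (by linarith)
  have bot : ∀ j, |(A 1 j : ℝ)| ≤ |ξ| * |(A 0 j : ℝ)| + c := by
    intro j
    have h := (abs_le_xiNorm ξ A j).trans hξA
    have h2 := abs_sub_abs_le_abs_sub (A 1 j : ℝ) (ξ * A 0 j)
    rw [abs_sub_comm, abs_mul] at h2
    linarith
  have h0 : 0 ≤ (|α| + |β|) * |s| + (1 + |ξ|) * E := by positivity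
  have h1 : ∀ i j, |(A i j : ℝ)| ≤ (P * |s| + Q) / Δ := by
    intro i j
    rw [le_div_iff₀ hΔ', mul_comm]
    have hle : (1 + |ξ|) * ((|α| + |β|) * |s| + (1 + |ξ|) * E) + c * Δ ≤ P * |s| + Q := by
      rw [hP, hQ]
      linarith [abs_nonneg s]
    have hcΔ : 0 ≤ c * Δ := by positivity
    have ht := top j
    have hb := mul_le_mul_of_nonneg_left (bot j) hΔ'.le
    have hξt := mul_le_mul_of_nonneg_left ht hξ0
    have h2 : 0 ≤ |ξ| * ((|α| + |β|) * |s| + (1 + |ξ|) * E) := by positivity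
    fin_cases i
    · change Δ * |(A 0 j : ℝ)| ≤ _
      linarith
    · change Δ * |(A 1 j : ℝ)| ≤ _
      linarith
  have h2 := mnorm_le h1
  rw [le_div_iff₀ hΔ'] at h2
  rw [div_le_iff₀ hΔ'] at hL
  rw [div_mul_eq_mul_div, div_le_iff₀ (by positivity)]
  linarith

lemma exists_contracting_adaptedCoords {ξ c κ : ℝ} (hκ : 0 < κ) :
    ∃ δ L : ℝ, 0 < δ ∧ ∀ A : M2, 0 < mnorm A → L ≤ mnorm A → xiNorm ξ A ≤ c →
      κ * mnorm A ≤ |(A 0 0 : ℝ) + ξ * A 0 1| → Contracting (adaptedCoords ξ δ A) := by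
  have hδ : 0 < κ / 2 := by linarith
  refine ⟨κ / 2, max (8 * c / κ) (8 * ((1 + |ξ|) * c) / (κ * (κ / 2))), hδ,
    fun A hA hL hξA hκA => ?_⟩
  have hL1 := (le_max_left _ _).trans hL
  have hL2 := (le_max_right _ _).trans hL
  rw [div_le_iff₀ (by positivity)] at hL1 hL2
  have hd0 := (abs_le_xiNorm ξ A 0).trans hξA
  have hd1 := (abs_le_xiNorm ξ A 1).trans hξA
  have hpos : 0 < κ * mnorm A := by positivity
  simp only [Contracting, adaptedCoords, Matrix.of_apply, Matrix.cons_val', Matrix.cons_val_zero,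
    Matrix.cons_val_one, Matrix.cons_val_fin_one]
  refine ⟨hpos.trans_le hκA, ?_, ?_, ?_⟩
  · rw [abs_mul, abs_of_pos hδ]
    have := mul_le_mul_of_nonneg_left (abs_le_mnorm A 0 1) hδ.le
    linarith
  · rw [abs_div, abs_neg, abs_of_pos hδ, div_le_iff₀ hδ]
    refine (abs_add_le _ _).trans ?_
    rw [abs_mul]
    have h1 := mul_le_mul_of_nonneg_left hd1 (abs_nonneg ξ)
    have h2 := mul_le_mul_of_nonneg_left hκA hδ.le
    linarith
  · rw [abs_neg]
    linarith

/-! ### A criterion for bad approximability -/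

lemma badlyApprox_of_matrix_seq {ξ : ℝ} (hξ : Irrational ξ) {U : ℕ → M2} {B G : ℝ}
    (hdet : ∀ n, (U n).det ≠ 0) (hB : ∀ n, xiNorm ξ (U n) * mnorm (U n) ≤ B) (hG : 0 ≤ G)
    (hgrow : ∀ n, mnorm (U (n + 1)) ≤ G * mnorm (U n))
    (hunb : ∀ C : ℝ, ∃ n, C < mnorm (U n)) : BadlyApprox ξ := by
  have hB0 : 0 ≤ B :=
    (mul_nonneg (xiNorm_nonneg ξ (U 0)) (mnorm_nonneg (U 0))).trans (hB 0)
  have hS := mnorm_nonneg (U 0)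
  set H : ℝ := mnorm (U 0) + 2 * B * G + 1 with hH
  have hBG : 0 ≤ 2 * B * G := by positivity
  have hH0 : 0 < H := by positivity
  refine ⟨hξ, 1 / (2 * H), by positivity, fun p q hq => ?_⟩
  have hq1 : (1 : ℝ) ≤ |(q : ℝ)| := by exact_mod_cast Int.one_le_abs hq
  have hex := hunb (2 * B * |(q : ℝ)|)
  classical
  obtain ⟨n, hn, hnH⟩ : ∃ n, 2 * B * |(q : ℝ)| < mnorm (U n) ∧ mnorm (U n) ≤ H * |(q : ℝ)| := by
    refine ⟨Nat.find hex, Nat.find_spec hex, ?_⟩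
    rcases hm : Nat.find hex with _ | m
    · nlinarith
    · have hlt := Nat.find_min hex (m := m) (by omega)
      rw [not_lt] at hlt
      refine (hgrow m).trans ((mul_le_mul_of_nonneg_left hlt hG).trans ?_)
      rw [hH]
      nlinarith
  have hn0 : 0 < mnorm (U n) := lt_of_le_of_lt (by positivity) hn
  obtain ⟨j, hj⟩ : ∃ j, U n 0 j * p - U n 1 j * q ≠ 0 := by
    by_contra! hcon
    have h0 := hcon 0
    have h1 := hcon 1
    apply hdet n
    rw [Matrix.det_fin_two]
    have : (U n 0 0 * U n 1 1 - U n 0 1 * U n 1 0) * q = 0 := by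
      linear_combination U n 0 1 * h0 - U n 0 0 * h1
    exact (mul_eq_zero.mp this).resolve_right hq
  have hj1 : (1 : ℝ) ≤ |(U n 0 j : ℝ) * p - U n 1 j * q| := by
    exact_mod_cast Int.one_le_abs hj
  have hsplit : (1 : ℝ) ≤ |(q : ℝ)| * xiNorm ξ (U n) + mnorm (U n) * |q * ξ - p| := by
    refine hj1.trans ?_
    rw [show (U n 0 j : ℝ) * p - U n 1 j * q =
      q * (ξ * U n 0 j - U n 1 j) - U n 0 j * (q * ξ - p) by ring]
    refine (abs_sub _ _).trans ?_
    rw [abs_mul, abs_mul]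
    exact add_le_add (mul_le_mul_of_nonneg_left (abs_le_xiNorm _ _ _) (abs_nonneg _))
      (mul_le_mul_of_nonneg_right (abs_le_mnorm _ _ _) (abs_nonneg _))
  have hhalf : |(q : ℝ)| * xiNorm ξ (U n) < 1 / 2 := by
    have h1 := mul_le_mul_of_nonneg_left (hB n) (abs_nonneg (q : ℝ))
    refine lt_of_mul_lt_mul_right (a := mnorm (U n)) ?_ hn0.le
    linarith
  have hfin : 1 / 2 < H * |(q : ℝ)| * |q * ξ - p| := by
    have := mul_le_mul_of_nonneg_right hnH (abs_nonneg ((q : ℝ) * ξ - p))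
    linarith
  have hqR : (q : ℝ) ≠ 0 := by exact_mod_cast hq
  have hq2 : (0 : ℝ) < (q : ℝ) ^ 2 := by positivity
  have e : |(q : ℝ)| * |q * ξ - p| = |ξ - p / q| * (q : ℝ) ^ 2 := by
    rw [← abs_mul, ← abs_of_pos hq2, ← abs_mul]
    congr 1
    field_simp
  rw [div_lt_iff₀ hq2, ← e, div_lt_iff₀ (by positivity)]
  linarith

/-! ### Fibonacci words -/

lemma fw_add_three (n : ℕ) : fw (n + 3) = fw (n + 2) ++ fw (n + 1) := rfl

lemma lt_length_fw (n : ℕ) : n < (fw (n + 2)).length := by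
  induction n using Nat.strong_induction_on with
  | _ n ih =>
    match n with
    | 0 => simp [fw]
    | 1 => simp [fw]
    | n + 2 =>
      have h1 := ih (n + 1) (by omega)
      have h2 := ih n (by omega)
      rw [fw_add_three, List.length_append]
      change n + 2 < (fw (n + 1 + 2)).length + (fw (n + 2)).length
      omega

lemma fw_prefix_fw {i j : ℕ} (hi : 2 ≤ i) (hij : i ≤ j) : fw i <+: fw j := by
  induction j, hij using Nat.le_induction with
  | base => exact List.prefix_rfl
  | succ j hij ih =>
    obtain ⟨k, rfl⟩ : ∃ k, j = k + 2 := ⟨j - 2, by omega⟩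
    exact ih.trans (List.prefix_append _ _)

lemma length_fpref (n : ℕ) : (fpref n).length = n := by
  rw [fpref, List.length_take]
  exact min_eq_left (lt_length_fw n).le

lemma fpref_prefix_fw {n K : ℕ} (hK : n + 2 ≤ K) : fpref n <+: fw K :=
  (List.take_prefix _ _).trans (fw_prefix_fw (by omega) hK)

lemma eq_fpref_of_prefix {l : List Bool} {K : ℕ} (hK : 2 ≤ K) (hl : l <+: fw K) :
    l = fpref l.length := by
  have h1 : l <+: fw (max K (l.length + 2)) := hl.trans (fw_prefix_fw hK (le_max_left _ _))
  have h2 : fpref l.length <+: fw (max K (l.length + 2)) := fpref_prefix_fw (le_max_right _ _)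
  exact (List.prefix_of_prefix_length_le h1 h2 (by rw [length_fpref])).eq_of_length
    (by rw [length_fpref])

lemma exists_fpref_succ (n : ℕ) : ∃ x, fpref (n + 1) = fpref n ++ [x] := by
  have h : fpref n <+: fpref (n + 1) :=
    List.prefix_of_prefix_length_le (fpref_prefix_fw (K := n + 3) (by omega))
      (fpref_prefix_fw (K := n + 3) (by omega)) (by simp [length_fpref])
  obtain ⟨t, ht⟩ := h
  have hlen := congrArg List.length ht
  rw [List.length_append, length_fpref, length_fpref] at hlen
  obtain ⟨x, rfl⟩ := List.length_eq_one_iff.mp (by omega : t.length = 1)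
  exact ⟨x, ht.symm⟩

/-- The substitution `b ↦ w_{m+1}`, `a ↦ w_{m+2}`. -/
def fibSubst (m : ℕ) (x : Bool) : List Bool := if x then fw (m + 2) else fw (m + 1)

lemma flatMap_fibSubst_fw (m k : ℕ) : (fw (k + 1)).flatMap (fibSubst m) = fw (k + m + 1) := by
  induction k using Nat.strong_induction_on with
  | _ k ih =>
    match k with
    | 0 => simp [fw, fibSubst]
    | 1 => simp [fw, fibSubst, Nat.add_comm 1 m]
    | k + 2 =>
      rw [fw_add_three, List.flatMap_append, ih (k + 1) (by omega), ih k (by omega),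
        show k + 2 + m + 1 = (k + m) + 3 by ring, fw_add_three]
      congr 2
      ring

lemma prod_map_flatMap {ι κ : Type*} (h : κ → M2) (σ : ι → List κ) (u : List ι) :
    ((u.flatMap σ).map h).prod = (u.map fun x => ((σ x).map h).prod).prod := by
  induction u with
  | nil => simp
  | cons x u ih => simp [ih]

lemma PhiW_fw {W : ℕ → M2} (hW : IsFibP W) (k : ℕ) : PhiW (W 1) (W 2) (fw (k + 1)) = W (k + 1) := by
  rw [PhiW_eq_red_prod]
  induction k using Nat.strong_induction_on with
  | _ k ih =>
    match k with
    | 0 => simpa [fw] using red_of_primitive (hW.1 1 le_rfl).1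
    | 1 => simpa [fw] using red_of_primitive (hW.1 2 (by norm_num)).1
    | k + 2 =>
      rw [fw_add_three, List.map_append, List.prod_append, ← red_mul_red, ← red_red_mul,
        ih (k + 1) (by omega), ih k (by omega)]
      exact (hW.2 (k + 1) (by omega)).symm

/-! ### Associated sequences -/

lemma one_le_gam : 1 ≤ gam := by
  have h : (1 : ℝ) ≤ Real.sqrt 5 := Real.one_le_sqrt.mpr (by norm_num)
  rw [gam]
  linarith

lemma IsExtremal.irrational {ξ : ℝ} (hξ : IsExtremal ξ) : Irrational ξ := by
  rintro ⟨r, rfl⟩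
  exact hξ.1 0 1 (-r) (by simp) (by push_cast; ring)

lemma IsAssociated.exists_contracting {ξ : ℝ} {W : ℕ → M2} (hξ : IsExtremal ξ)
    (hW : IsAssociated ξ W) :
    ∃ (m : ℕ) (δ : ℝ), 0 < δ ∧ Contracting (adaptedCoords ξ δ (W (m + 1))) ∧
      Contracting (adaptedCoords ξ δ (W (m + 2))) := by
  obtain ⟨-, hunb, ⟨N, -, -, hN, hsymm⟩, c₁, _, _, c₄, _, _, hc₁, -, -, hc₄, -, -, hc⟩ := hW
  have hNt : Nᵀ ≠ -Nᵀᵀ := by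
    rw [Matrix.transpose_transpose]
    intro h
    apply hN
    rw [h, neg_neg]
  obtain ⟨κ, L, hκ, hL⟩ := exists_mnorm_le_abs_of_isSymm hξ.1 hN hc₄.le
  obtain ⟨κ', L', hκ', hL'⟩ := exists_mnorm_le_abs_of_isSymm hξ.1 hNt hc₄.le
  obtain ⟨δ, M, hδ, hM⟩ :=
    exists_contracting_adaptedCoords (ξ := ξ) (c := c₄) (lt_min hκ hκ')
  have hcontr : ∀ i, 1 ≤ i → max 1 (max M (max L L')) ≤ mnorm (W i) →
      Contracting (adaptedCoords ξ δ (W i)) := by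
    intro i hi hle
    obtain ⟨h1, hle⟩ := max_le_iff.mp hle
    obtain ⟨h2, hle⟩ := max_le_iff.mp hle
    obtain ⟨h3, h4⟩ := max_le_iff.mp hle
    have hxi : xiNorm ξ (W i) ≤ c₄ :=
      (hc i hi).2.2.2.1.trans (mul_le_of_le_one_right hc₄.le (inv_le_one_of_one_le₀ h1))
    refine hM _ (by linarith) h2 hxi ?_
    have hs := hsymm i hi
    split_ifs at hs
    · exact (mul_le_mul_of_nonneg_right (min_le_right _ _) (mnorm_nonneg _)).trans
        (hL' _ hs h4 hxi)
    · exact (mul_le_mul_of_nonneg_right (min_le_left _ _) (mnorm_nonneg _)).trans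
        (hL _ hs h3 hxi)
  set R := max 1 (max M (max L L')) with hR
  have hR1 : 1 ≤ R := le_max_left _ _
  obtain ⟨i, hi, hWi⟩ := hunb (max R (R / c₁))
  obtain ⟨m, rfl⟩ : ∃ m, i = m + 1 := ⟨i - 1, by omega⟩
  have hWR : R ≤ mnorm (W (m + 1)) := (le_max_left _ _).trans hWi.le
  have hWc : R / c₁ ≤ mnorm (W (m + 1)) := (le_max_right _ _).trans hWi.le
  refine ⟨m, δ, hδ, hcontr _ hi hWR, hcontr _ (by omega) ?_⟩
  rw [div_le_iff₀ hc₁] at hWc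
  have hpow := Real.self_le_rpow_of_one_le (hR1.trans hWR) one_le_gam
  have := mul_le_mul_of_nonneg_left hpow hc₁.le
  linarith [(hc (m + 1) hi).1]

lemma IsAssociated.detControlled {ξ : ℝ} {W : ℕ → M2} (hW : IsAssociated ξ W) :
    ∃ C : ℝ, ∀ i, 1 ≤ i → DetControlled ξ C (W i) := by
  obtain ⟨hfib, -, -, _, _, _, c₄, _, _, -, -, -, hc₄, -, -, hc⟩ := hW
  refine ⟨c₄, fun i hi => ?_⟩
  have hdet : (1 : ℝ) ≤ |((W i).det : ℝ)| := by
    exact_mod_cast Int.one_le_abs (hfib.1 i hi).2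
  refine (mul_le_mul_of_nonneg_right (hc i hi).2.2.2.1 (mnorm_nonneg _)).trans ?_
  rw [mul_assoc]
  refine mul_le_mul_of_nonneg_left ?_ hc₄.le
  exact (inv_mul_le_one (a := mnorm (W i))).trans hdet

/-- The unreduced product of the matrices attached to the letters of a word. -/
def wordProd (A B : M2) (u : List Bool) : M2 := (u.map fun x => if x then B else A).prod

lemma PhiW_eq_red_wordProd (A B : M2) (u : List Bool) : PhiW A B u = red (wordProd A B u) :=
  PhiW_eq_red_prod A B u

lemma wordProd_append (A B : M2) (u v : List Bool) :
    wordProd A B (u ++ v) = wordProd A B u * wordProd A B v := by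
  simp [wordProd]

lemma wordProd_det_ne_zero {A B : M2} (hA : A.det ≠ 0) (hB : B.det ≠ 0) (u : List Bool) :
    (wordProd A B u).det ≠ 0 :=
  det_list_prod_ne_zero _ (fun x => by cases x <;> simpa) u

lemma mnorm_PhiW_append_le (A B : M2) (u v : List Bool) :
    mnorm (PhiW A B (u ++ v)) ≤ 2 * mnorm (wordProd A B v) * mnorm (PhiW A B u) := by
  rw [PhiW_eq_red_wordProd, PhiW_eq_red_wordProd, wordProd_append, ← red_red_mul]
  refine (mnorm_red_le _).trans ((mnorm_mul_le _ _).trans (le_of_eq ?_))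
  ring

/-- The prefixes of `f_{a,b}` which are products of the words `w_{m+1}` and `w_{m+2}`. -/
def coarsePrefix (m n : ℕ) : List Bool := (fpref n).flatMap (fibSubst m)

lemma coarsePrefix_prefix_fw (m n : ℕ) :
    ∃ v : List Bool, coarsePrefix m n ++ v.flatMap (fibSubst m) = fw (n + m + 2) := by
  obtain ⟨v, hv⟩ := fpref_prefix_fw (le_refl (n + 2))
  refine ⟨v, ?_⟩
  rw [coarsePrefix, ← List.flatMap_append, hv, flatMap_fibSubst_fw]
  congr 1
  ring

lemma coarsePrefix_eq_fpref (m n : ℕ) :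
    coarsePrefix m n = fpref (coarsePrefix m n).length := by
  obtain ⟨v, hv⟩ := coarsePrefix_prefix_fw m n
  exact eq_fpref_of_prefix (K := n + m + 2) (by omega) ⟨_, hv⟩

lemma exists_detControlled_coarsePrefix {ξ : ℝ} {W : ℕ → M2} (hW : IsAssociated ξ W)
    {m : ℕ} {δ : ℝ} (hδ : 0 < δ) (h₁ : Contracting (adaptedCoords ξ δ (W (m + 1))))
    (h₂ : Contracting (adaptedCoords ξ δ (W (m + 2)))) :
    ∃ C : ℝ, ∀ n, DetControlled ξ C (PhiW (W 1) (W 2) (coarsePrefix m n)) := by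
  have hfib := hW.1
  have hdet : ∀ u, (wordProd (W 1) (W 2) u).det ≠ 0 :=
    wordProd_det_ne_zero (hfib.1 1 le_rfl).2 (hfib.1 2 (by norm_num)).2
  have hred : ∀ k, red (wordProd (W 1) (W 2) (fw (k + 1))) = W (k + 1) := fun k => by
    rw [← PhiW_eq_red_wordProd, PhiW_fw hfib]
  have hcontr : ∀ k, Contracting (adaptedCoords ξ δ (W (k + 1))) →
      Contracting (adaptedCoords ξ δ (wordProd (W 1) (W 2) (fw (k + 1)))) := by
    intro k hk
    rw [← hred k] at hk
    rw [← content_smul_red (wordProd (W 1) (W 2) (fw (k + 1))), adaptedCoords_smul]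
    refine Contracting.of_smul ?_ hk
    exact_mod_cast (content_pos (ne_zero_of_det_ne_zero (hdet _))).ne'
  have hsubst : ∀ u : List Bool,
      ∀ A ∈ u.map fun x => wordProd (W 1) (W 2) (fibSubst m x),
        Contracting (adaptedCoords ξ δ A) := by
    intro u A hA
    obtain ⟨x, -, rfl⟩ := List.mem_map.mp hA
    cases x
    · exact hcontr m h₁
    · exact hcontr (m + 1) h₂
  obtain ⟨c, hc, hmul⟩ := exists_mnorm_mul_le ξ hδ
  obtain ⟨C, hC⟩ := hW.detControlled
  refine ⟨2 * c * C, fun n => ?_⟩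
  obtain ⟨v, hv⟩ := coarsePrefix_prefix_fw m n
  rw [PhiW_eq_red_wordProd, detControlled_red (ne_zero_of_det_ne_zero (hdet _))]
  refine DetControlled.left_factor hc (V := wordProd (W 1) (W 2) (v.flatMap (fibSubst m)))
    (hdet _) ?_ ?_
  · have := hmul _ _ (hsubst (fpref n)) (hsubst v)
    simpa only [wordProd, coarsePrefix, prod_map_flatMap] using this
  · rw [← wordProd_append, hv, ← detControlled_red (ne_zero_of_det_ne_zero (hdet _)), hred]
    exact hC _ (by omega)

/-- If the determinants of the matrices U_i = Φ(u_i) are bounded, then ξ is badly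
approximable. -/
theorem stmt6 (ξ : ℝ) (W : ℕ → M2) (hξ : IsExtremal ξ) (hW : IsAssociated ξ W)
    (hbd : ∃ C : ℝ, ∀ i, 1 ≤ i → |((PhiW (W 1) (W 2) (fpref i)).det : ℝ)| ≤ C) :
    BadlyApprox ξ := by
  obtain ⟨C, hC⟩ := hbd
  obtain ⟨m, δ, hδ, h₁, h₂⟩ := hW.exists_contracting hξ
  obtain ⟨B, hB⟩ := exists_detControlled_coarsePrefix hW hδ h₁ h₂
  have hfib := hW.1
  have hprod : ∀ u, wordProd (W 1) (W 2) u ≠ 0 := fun u => ne_zero_of_det_ne_zero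
    (wordProd_det_ne_zero (hfib.1 1 le_rfl).2 (hfib.1 2 (by norm_num)).2 u)
  have hdet : ∀ u, (PhiW (W 1) (W 2) u).det ≠ 0 := by
    intro u h
    refine wordProd_det_ne_zero (hfib.1 1 le_rfl).2 (hfib.1 2 (by norm_num)).2 u ?_
    rw [← content_smul_red (wordProd (W 1) (W 2) u), ← PhiW_eq_red_wordProd, Matrix.det_smul, h,
      mul_zero]
  set g : Bool → ℝ := fun x => 2 * mnorm (wordProd (W 1) (W 2) (fibSubst m x)) with hg
  have hg0 : ∀ x, 0 ≤ g x := fun x => mul_nonneg zero_le_two (mnorm_nonneg _)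
  refine badlyApprox_of_matrix_seq hξ.irrational
    (U := fun n => PhiW (W 1) (W 2) (coarsePrefix m n)) (B := |B| * max C 1)
    (G := g true + g false) (fun n => hdet _) (fun n => ?_) (add_nonneg (hg0 _) (hg0 _))
    (fun n => ?_) (fun R => ?_)
  · have hdC : |((PhiW (W 1) (W 2) (coarsePrefix m n)).det : ℝ)| ≤ max C 1 := by
      rcases Nat.eq_zero_or_pos (coarsePrefix m n).length with h | h
      · rw [List.length_eq_zero_iff] at h
        simp [h, PhiW]
      · rw [coarsePrefix_eq_fpref]
        exact (hC _ h).trans (le_max_left _ _)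
    exact (hB n).trans ((mul_le_mul_of_nonneg_right (le_abs_self B) (abs_nonneg _)).trans
      (mul_le_mul_of_nonneg_left hdC (abs_nonneg B)))
  · obtain ⟨x, hx⟩ := exists_fpref_succ n
    have hsucc : coarsePrefix m (n + 1) = coarsePrefix m n ++ fibSubst m x := by
      simp [coarsePrefix, hx]
    simp only [hsucc]
    refine (mnorm_PhiW_append_le _ _ _ _).trans
      (mul_le_mul_of_nonneg_right ?_ (mnorm_nonneg _))
    cases x
    · exact le_add_of_nonneg_left (hg0 true)
    · exact le_add_of_nonneg_right (hg0 false)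
  · obtain ⟨i, -, hWi⟩ := hW.2.1 (max R (∑ j ∈ Finset.range (m + 2), mnorm (W j)))
    have hi : m + 2 ≤ i := by
      by_contra! hlt
      have := Finset.single_le_sum (f := fun j => mnorm (W j)) (fun j _ => mnorm_nonneg _)
        (Finset.mem_range.mpr hlt)
      exact absurd ((le_max_right _ _).trans_lt hWi) (not_lt.mpr this)
    obtain ⟨k, rfl⟩ : ∃ k, i = (k + 1) + m + 1 := ⟨i - m - 2, by omega⟩
    refine ⟨(fw (k + 2)).length, ?_⟩
    rw [coarsePrefix, ← eq_fpref_of_prefix (K := k + 2) (by omega) List.prefix_rfl,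
      flatMap_fibSubst_fw, PhiW_fw hfib]
    exact (le_max_left _ _).trans_lt hWi
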